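/- arXiv:2605.28503 — 2 statements merged into one kernel-verified Lean document; each statement's English description precedes it below -/
import Mathlib

section
/- Let D be poised Birkhoff interpolation data with (y^0, 0) ∈ D, every |α^i| ≤ 2, and Δ(Y) ≤ Δ. Let f : R^n → R be twice continuously differentiable with ∇²f Lipschitz continuous with constant L on an open set containing B̄(y^0, 2Δ), and let m(y^0 + s) = c + g^T s + (1/2) s^T H s be the quadratic Birkhoff interpolant of f, i.e., (∂^{α^i} m)(y^i) = (∂^{α^i} f)(y^i) for all i = 0, …, q. Let n_ℓ = #{i : |α^i| = ℓ} for ℓ = 0, 1, 2. Then for all y in the closed ball B̄(y^0, Δ), the Hessian error satisfies ‖∇²m(y) − ∇²f(y)‖ = ‖H − ∇²f(y)‖ ≤ √2 · ((9/4)n_0 + 4 n_1 + 4 n_2)^{1/2} · L · ‖M̂^{-1}‖₂ · Δ. -/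
noncomputable section

open Metric

/-- `ℝ^n` with the Euclidean norm. -/
abbrev E (n : ℕ) := EuclideanSpace ℝ (Fin n)

/-- Partial derivative in coordinate `i`. -/
def pd {n : ℕ} (i : Fin n) (f : E n → ℝ) : E n → ℝ :=
  fun x => fderiv ℝ f x (EuclideanSpace.single i 1)

/-- Mixed partial derivative `∂^α` associated with the multi-index `α`. -/
def mpd {n : ℕ} (α : Fin n → ℕ) (f : E n → ℝ) : E n → ℝ :=
  (List.finRange n).foldr (fun i g => (pd i)^[α i] g) f

/-- The order `|α|` of a multi-index. -/
def mdeg {n : ℕ} (α : Fin n → ℕ) : ℕ := ∑ j, α j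

/-- Index type for the natural basis of quadratic polynomials in `n` variables:
`1`, the `n` linear monomials, and the quadratic monomials indexed by unordered pairs.
Its cardinality is `q + 1 = (n+1)(n+2)/2`. -/
abbrev BIdx (n : ℕ) := Unit ⊕ Fin n ⊕ Sym2 (Fin n)

/-- The natural basis `1, x_1, …, x_n, (1/2)x_1², x_1x_2, …, (1/2)x_n²` of `P_n^2`. -/
def natBasis {n : ℕ} : BIdx n → E n → ℝ
  | Sum.inl _ => fun _ => 1
  | Sum.inr (Sum.inl i) => fun x => x i
  | Sum.inr (Sum.inr s) => fun x =>
      Sym2.lift ⟨fun i j => (if i = j then (1:ℝ)/2 else 1) * (x i * x j), by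
        intro a b
        by_cases h : a = b
        · subst h; ring
        · simp only [if_neg h, if_neg (Ne.symm h)]; ring⟩ s

/-- The base point `y^0` of interpolation data. -/
def center {n : ℕ} (y : BIdx n → E n) : E n := y (Sum.inl ())

/-- `Δ(Y) = max_i ‖y^i − y^0‖`. -/
def rad {n : ℕ} (y : BIdx n → E n) : ℝ :=
  Finset.univ.sup' Finset.univ_nonempty fun i => ‖y i - center y‖

/-- The normalized points `ŷ^i = (y^i − y^0)/Δ(Y)`. -/
def yhat {n : ℕ} (y : BIdx n → E n) (i : BIdx n) : E n := (rad y)⁻¹ • (y i - center y)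

/-- The normalized interpolation matrix `M̂_{ij} = (∂^{α^i} φ_j)(ŷ^i)`. -/
def Mhat {n : ℕ} (y : BIdx n → E n) (α : BIdx n → Fin n → ℕ) : Matrix (BIdx n) (BIdx n) ℝ :=
  Matrix.of fun i j => mpd (α i) (natBasis j) (yhat y i)

/-- The quadratic polynomial with coefficient vector `v` in the natural basis. -/
def evalP {n : ℕ} (v : BIdx n → ℝ) : E n → ℝ := fun x => ∑ j, v j * natBasis j x

/-- `v` lists the coefficient vectors of the Birkhoff interpolation polynomials:
`∂^{α^{i'}} λ_i (ŷ^{i'}) = δ_{i i'}`. -/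
def BirkhoffLam {n : ℕ} (y : BIdx n → E n) (α : BIdx n → Fin n → ℕ)
    (v : BIdx n → BIdx n → ℝ) : Prop :=
  ∀ i i', mpd (α i') (evalP (v i)) (yhat y i') = if i = i' then 1 else 0

/-- The spectral (ℓ²-operator) norm of a real matrix. -/
def specNorm {ι : Type*} [Fintype ι] [DecidableEq ι] (M : Matrix ι ι ℝ) : ℝ :=
  ‖Matrix.toEuclideanCLM (𝕜 := ℝ) M‖

/-- `q + 1 = (n+1)(n+2)/2`. -/
def Q1 (n : ℕ) : ℕ := (n + 1) * (n + 2) / 2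

/-- The quadratic model `m(y^0 + s) = c + gᵀs + (1/2)sᵀHs`, as a function of `x = y^0 + s`. -/
def quadModel {n : ℕ} (c : ℝ) (g : Fin n → ℝ) (H : Matrix (Fin n) (Fin n) ℝ)
    (y0 : E n) : E n → ℝ :=
  fun x => c + (∑ i, g i * (x i - y0 i)) +
    (1 / 2) * ∑ i, ∑ j, (x i - y0 i) * H i j * (x j - y0 j)

/-- The Hessian matrix of `f` at `x`. -/
def hessMat {n : ℕ} (f : E n → ℝ) (x : E n) : Matrix (Fin n) (Fin n) ℝ :=
  Matrix.of fun i j =>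
    fderiv ℝ (fderiv ℝ f) x (EuclideanSpace.single i 1) (EuclideanSpace.single j 1)

/-- The gradient of `f` at `x` as a vector. -/
def gradVec {n : ℕ} (f : E n → ℝ) (x : E n) : Fin n → ℝ :=
  fun i => fderiv ℝ f x (EuclideanSpace.single i 1)

/-- `n_ℓ`, the number of interpolation conditions of derivative order `ℓ`. -/
def ncount {n : ℕ} (α : BIdx n → Fin n → ℕ) (ℓ : ℕ) : ℕ :=
  (Finset.univ.filter fun i => mdeg (α i) = ℓ).card

/-- `((9/4)n_0 + 4n_1 + 4n_2)^{1/2}`. -/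
def kfac {n : ℕ} (α : BIdx n → Fin n → ℕ) : ℝ :=
  Real.sqrt ((9 / 4) * ncount α 0 + 4 * ncount α 1 + 4 * ncount α 2)

lemma foldr_pd_replicate {n : ℕ} (i : Fin n) (k : ℕ) (F : E n → ℝ) :
    (List.replicate k i).foldr pd F = (pd i)^[k] F := by
  induction k with
  | zero => rfl
  | succ k ih => rw [Function.iterate_succ_apply', ← ih]; rfl

lemma mpd_list_aux {n : ℕ} (α : Fin n → ℕ) (l : List (Fin n)) (F : E n → ℝ) :
    l.foldr (fun i g => (pd i)^[α i] g) F =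
      (l.flatMap fun i => List.replicate (α i) i).foldr pd F := by
  induction l with
  | nil => rfl
  | cons a l ih =>
    simp only [List.foldr_cons, List.flatMap_cons, List.foldr_append]
    rw [foldr_pd_replicate, ih]

lemma mpd_list {n : ℕ} (α : Fin n → ℕ) :
    ∃ l : List (Fin n), l.length = mdeg α ∧ ∀ F : E n → ℝ, mpd α F = l.foldr pd F := by
  refine ⟨(List.finRange n).flatMap fun i => List.replicate (α i) i, ?_, fun F => mpd_list_aux _ _ _⟩
  simp [List.length_flatMap, mdeg, Fin.sum_univ_def]

lemma pd_smooth {n : ℕ} (i : Fin n) {F : E n → ℝ} (hF : ContDiff ℝ (⊤ : ℕ∞) F) :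
    ContDiff ℝ (⊤ : ℕ∞) (pd i F) := by
  have h : ContDiff ℝ (⊤ : ℕ∞) (fderiv ℝ F) := hF.fderiv_right (by simp)
  exact h.clm_apply contDiff_const

lemma foldr_smooth {n : ℕ} (l : List (Fin n)) {F : E n → ℝ} (hF : ContDiff ℝ (⊤ : ℕ∞) F) :
    ContDiff ℝ (⊤ : ℕ∞) (l.foldr pd F) := by
  induction l with
  | nil => exact hF
  | cons a l ih => exact pd_smooth a ih

lemma foldr_sum {n : ℕ} {ι : Type*} [Fintype ι] (l : List (Fin n)) (v : ι → ℝ) (φ : ι → E n → ℝ)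
    (hφ : ∀ j, ContDiff ℝ (⊤ : ℕ∞) (φ j)) :
    l.foldr pd (fun x => ∑ j, v j * φ j x) = fun x => ∑ j, v j * l.foldr pd (φ j) x := by
  induction l with
  | nil => rfl
  | cons a l ih =>
    funext x
    simp only [List.foldr_cons]
    rw [ih]
    have hd : ∀ j, DifferentiableAt ℝ (l.foldr pd (φ j)) x := fun j =>
      (foldr_smooth l (hφ j)).differentiable (by simp) x
    simp only [pd]
    have h2 : HasFDerivAt (fun x => ∑ j, v j * l.foldr pd (φ j) x)
        (∑ j, v j • fderiv ℝ (l.foldr pd (φ j)) x) x :=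
      HasFDerivAt.fun_sum fun j _ => (hd j).hasFDerivAt.const_mul (v j)
    rw [h2.fderiv]
    simp

lemma foldr_sub {n : ℕ} (l : List (Fin n)) {F G : E n → ℝ}
    (hF : ContDiff ℝ (⊤ : ℕ∞) F) (hG : ContDiff ℝ (⊤ : ℕ∞) G) (x : E n) :
    l.foldr pd (fun x => F x - G x) x = l.foldr pd F x - l.foldr pd G x := by
  have := congrFun (foldr_sum (ι := Bool) l (fun b => if b then 1 else -1)
    (fun b => if b then F else G) (by intro b; cases b <;> simpa)) x
  simpa [sub_eq_add_neg] using this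

lemma foldr_scale {n : ℕ} (l : List (Fin n)) (d : ℝ) (y0 : E n) {F : E n → ℝ}
    (hF : ContDiff ℝ (⊤ : ℕ∞) F) :
    l.foldr pd (fun x => F (d • (x - y0))) =
      fun x => d ^ l.length * l.foldr pd F (d • (x - y0)) := by
  induction l with
  | nil => simp
  | cons a l ih =>
    funext x
    simp only [List.foldr_cons]
    rw [ih]
    have hd : DifferentiableAt ℝ (l.foldr pd F) (d • (x - y0)) :=
      (foldr_smooth l hF).differentiable (by simp) _
    have h1 : HasFDerivAt (fun x : E n => d • (x - y0)) (d • ContinuousLinearMap.id ℝ (E n)) x :=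
      ((hasFDerivAt_id x).sub_const y0).const_smul d
    have h2 := (hd.hasFDerivAt.comp x h1).const_mul (d ^ l.length)
    simp only [pd]
    have h3 : fderiv ℝ (fun x => d ^ l.length * l.foldr pd F (d • (x - y0))) x = _ :=
      HasFDerivAt.fderiv h2
    rw [h3]
    simp [pow_succ]
    ring

lemma natBasis_smooth {n : ℕ} (j : BIdx n) : ContDiff ℝ (⊤ : ℕ∞) (natBasis j) := by
  rcases j with _ | i | s
  · exact contDiff_const
  · simp only [natBasis]; fun_prop
  · induction s using Sym2.ind with
    | _ a b => simp only [natBasis, Sym2.lift_mk]; fun_prop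

lemma quadModel_smooth {n : ℕ} (c : ℝ) (g : Fin n → ℝ) (H : Matrix (Fin n) (Fin n) ℝ)
    (y0 : E n) : ContDiff ℝ (⊤ : ℕ∞) (quadModel c g H y0) := by
  unfold quadModel
  fun_prop

/-- multiplicity of an unordered pair -/
def mult {n : ℕ} (s : Sym2 (Fin n)) : ℝ := if s.IsDiag then 1 else 2

lemma sum_pairs {n : ℕ} (a : Sym2 (Fin n) → ℝ) :
    ∑ i, ∑ j, a s(i, j) = ∑ s, mult s * a s := by
  classical
  rw [← Fintype.sum_prod_type' (f := fun i j => a s(i, j)),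
    ← Finset.sum_fiberwise (s := Finset.univ) (g := fun p : Fin n × Fin n => s(p.1, p.2))]
  refine Finset.sum_congr rfl fun s _ => ?_
  induction s using Sym2.ind with
  | _ x y =>
    have : (Finset.univ.filter fun p : Fin n × Fin n => s(p.1, p.2) = s(x, y))
        = {(x, y), (y, x)} := by
      ext ⟨p, q⟩
      simp
    rw [this]
    by_cases h : x = y
    · subst h; simp [mult]
    · rw [Finset.sum_pair (by simp [h])]
      simp [mult, h, Sym2.eq_swap (a := y) (b := x)]
      ring

/-- entry of a symmetric matrix -/
def symEntry {n : ℕ} (H : Matrix (Fin n) (Fin n) ℝ) (hH : H.IsSymm) : Sym2 (Fin n) → ℝ :=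
  Sym2.lift ⟨fun i j => H i j, fun i j => (hH.apply i j).symm⟩

/-- coefficients of a quadratic model -/
def coef {n : ℕ} (d c : ℝ) (g : Fin n → ℝ) (H : Matrix (Fin n) (Fin n) ℝ) (hH : H.IsSymm) :
    BIdx n → ℝ
  | Sum.inl _ => c
  | Sum.inr (Sum.inl i) => d * g i
  | Sum.inr (Sum.inr s) => d ^ 2 * symEntry H hH s

lemma quadModel_eq {n : ℕ} (d c : ℝ) (hd : d ≠ 0) (g : Fin n → ℝ) (H : Matrix (Fin n) (Fin n) ℝ)
    (hH : H.IsSymm) (y0 : E n) :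
    quadModel c g H y0 = fun x => evalP (coef d c g H hH) (d⁻¹ • (x - y0)) := by
  funext x
  have key := sum_pairs (fun s => Sym2.lift ⟨fun i j => (x i - y0 i) * H i j * (x j - y0 j), by
    intro i j; have := hH.apply i j; simp only [this]; ring⟩ s)
  simp only [Sym2.lift_mk] at key
  simp only [quadModel, evalP, Fintype.sum_sum_type, coef, natBasis]
  rw [key, Finset.mul_sum]
  simp only [Finset.univ_unique, Finset.sum_singleton, mul_one, add_assoc]
  congr 2
  · refine Finset.sum_congr rfl fun i _ => ?_
    simp
    field_simp
  · refine Finset.sum_congr rfl fun s _ => ?_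
    induction s using Sym2.ind with
    | _ a b =>
      simp [mult, symEntry]
      by_cases h : a = b
      · simp [h]; field_simp
      · simp [h]; field_simp

lemma frob_le {n : ℕ} (d c : ℝ) (g : Fin n → ℝ) (H : Matrix (Fin n) (Fin n) ℝ)
    (hH : H.IsSymm) :
    d ^ 4 * ∑ i, ∑ j, H i j ^ 2 ≤ 2 * ∑ k, coef d c g H hH k ^ 2 := by
  have key := sum_pairs (fun s => symEntry H hH s ^ 2)
  have e : ∀ i j, symEntry H hH s(i, j) = H i j := fun i j => rfl
  simp only [e] at key
  rw [key, Fintype.sum_sum_type, Fintype.sum_sum_type, Finset.mul_sum]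
  have h1 : ∑ s, d ^ 4 * (mult s * symEntry H hH s ^ 2) ≤
      2 * ∑ s, coef d c g H hH (Sum.inr (Sum.inr s)) ^ 2 := by
    rw [Finset.mul_sum]
    refine Finset.sum_le_sum fun s _ => ?_
    simp only [coef]
    have : mult s ≤ 2 := by unfold mult; split_ifs <;> norm_num
    have h3 : 0 ≤ d ^ 4 * symEntry H hH s ^ 2 := by positivity
    nlinarith
  have h2 : 0 ≤ ∑ s, coef d c g H hH (Sum.inl s) ^ 2 := by positivity
  have h3 : 0 ≤ ∑ s, coef d c g H hH (Sum.inr (Sum.inl s)) ^ 2 := by positivity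
  linarith

lemma specNorm_mulVec {ι : Type*} [Fintype ι] [DecidableEq ι] (M : Matrix ι ι ℝ) (v : ι → ℝ) :
    ∑ i, (M.mulVec v) i ^ 2 ≤ specNorm M ^ 2 * ∑ i, v i ^ 2 := by
  have h := (Matrix.toEuclideanCLM (𝕜 := ℝ) M).le_opNorm (WithLp.toLp 2 v)
  have h2 := pow_le_pow_left₀ (norm_nonneg _) h 2
  rw [mul_pow, EuclideanSpace.real_norm_sq_eq, EuclideanSpace.real_norm_sq_eq] at h2
  simpa [specNorm] using h2

lemma specNorm_nonneg {ι : Type*} [Fintype ι] [DecidableEq ι] (M : Matrix ι ι ℝ) :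
    0 ≤ specNorm M := norm_nonneg _

lemma specNorm_add_le {ι : Type*} [Fintype ι] [DecidableEq ι] (M N : Matrix ι ι ℝ) :
    specNorm (M + N) ≤ specNorm M + specNorm N := by
  unfold specNorm; rw [map_add]; exact norm_add_le _ _

lemma specNorm_le_frob {ι : Type*} [Fintype ι] [DecidableEq ι] (M : Matrix ι ι ℝ) (K : ℝ)
    (hK : 0 ≤ K) (h : ∑ i, ∑ j, M i j ^ 2 ≤ K ^ 2) : specNorm M ≤ K := by
  refine ContinuousLinearMap.opNorm_le_bound _ hK fun x => ?_
  refine abs_le_of_sq_le_sq' ?_ (by positivity) |>.2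
  rw [mul_pow, EuclideanSpace.real_norm_sq_eq, EuclideanSpace.real_norm_sq_eq]
  calc _ ≤ ∑ i, (∑ j, M i j ^ 2) * ∑ j, x j ^ 2 := by
        refine Finset.sum_le_sum fun i _ => ?_
        rw [Matrix.ofLp_toEuclideanCLM]
        exact Finset.sum_mul_sq_le_sq_mul_sq _ _ _
    _ = (∑ i, ∑ j, M i j ^ 2) * ∑ j, x j ^ 2 := by rw [Finset.sum_mul]
    _ ≤ _ := by gcongr

lemma one_le_specNorm_inv {ι : Type*} [Fintype ι] [DecidableEq ι] (M : Matrix ι ι ℝ)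
    (hM : IsUnit M) (k : ι) (hk : ∀ j, M k j = if j = k then 1 else 0) : 1 ≤ specNorm M⁻¹ := by
  have hdet : IsUnit M.det := (Matrix.isUnit_iff_isUnit_det M).1 hM
  have h1 : M⁻¹ k k = 1 := by
    have := congrFun (congrFun (Matrix.mul_nonsing_inv M hdet) k) k
    simpa [Matrix.mul_apply, hk] using this
  have h2 := specNorm_mulVec M⁻¹ (Pi.single k 1)
  have h3 : (M⁻¹.mulVec (Pi.single k 1)) k ^ 2 ≤ ∑ i, (M⁻¹.mulVec (Pi.single k 1)) i ^ 2 :=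
    Finset.single_le_sum (f := fun i => (M⁻¹.mulVec (Pi.single k 1)) i ^ 2)
      (fun i _ => sq_nonneg _) (Finset.mem_univ k)
  have h4 : ∑ i, (Pi.single k (1:ℝ) : ι → ℝ) i ^ 2 = 1 := by
    simp [Pi.single_apply]
  rw [h4] at h2
  have h5 : (M⁻¹.mulVec (Pi.single k 1)) k = 1 := by simp [h1]
  rw [h5] at h3
  have := specNorm_nonneg M⁻¹
  nlinarith

lemma clm_expand {n : ℕ} (A : E n →L[ℝ] ℝ) (u : E n) :
    A u = ∑ i, A (EuclideanSpace.single i 1) * u i := by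
  have h : u = ∑ i, u i • EuclideanSpace.single i (1:ℝ) := by
    ext j
    simp [Pi.single_apply]
  conv_lhs => rw [h]
  simp [map_sum, mul_comm]

lemma bilin_expand {n : ℕ} (B : E n →L[ℝ] E n →L[ℝ] ℝ) (u w : E n) :
    B u w = ∑ i, ∑ j, u i * B (EuclideanSpace.single i 1) (EuclideanSpace.single j 1) * w j := by
  rw [clm_expand (B u) w, Finset.sum_comm]
  refine Finset.sum_congr rfl fun j _ => ?_
  have := clm_expand (B.flip (EuclideanSpace.single j 1)) u
  simp only [ContinuousLinearMap.flip_apply] at this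
  rw [this, Finset.sum_mul]
  refine Finset.sum_congr rfl fun i _ => ?_
  ring

lemma bilin_norm_le {n : ℕ} (B : E n →L[ℝ] E n →L[ℝ] ℝ) (M : Matrix (Fin n) (Fin n) ℝ)
    (hM : ∀ i j, M i j = B (EuclideanSpace.single i 1) (EuclideanSpace.single j 1)) :
    ‖B‖ ≤ specNorm M := by
  refine ContinuousLinearMap.opNorm_le_bound₂ _ (specNorm_nonneg _) fun u w => ?_
  have h : B u w = inner ℝ u (Matrix.toEuclideanCLM (𝕜 := ℝ) M w) := by
    rw [Matrix.inner_toEuclideanCLM, bilin_expand]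
    simp only [dotProduct, Matrix.mulVec, hM, Finset.mul_sum, mul_assoc]
  rw [h]
  calc _ ≤ ‖u‖ * ‖Matrix.toEuclideanCLM (𝕜 := ℝ) M w‖ := norm_inner_le_norm _ _
    _ ≤ ‖u‖ * (specNorm M * ‖w‖) := by
      gcongr
      exact ContinuousLinearMap.le_opNorm _ _
    _ = _ := by ring

/-- second order Taylor polynomial -/
def taylor {n : ℕ} (a : ℝ) (A : E n →L[ℝ] ℝ) (B : E n →L[ℝ] E n →L[ℝ] ℝ) (y0 : E n) : E n → ℝ :=
  fun x => a + A (x - y0) + (1 / 2) * B (x - y0) (x - y0)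

lemma taylor_hasFDeriv {n : ℕ} (a : ℝ) (A : E n →L[ℝ] ℝ) (B : E n →L[ℝ] E n →L[ℝ] ℝ) (y0 : E n)
    (hB : ∀ u w, B u w = B w u) (x : E n) :
    HasFDerivAt (taylor a A B y0) (A + B (x - y0)) x := by
  have h0 : HasFDerivAt (fun x : E n => x - y0) (ContinuousLinearMap.id ℝ (E n)) x :=
    (hasFDerivAt_id x).sub_const y0
  have h1 : HasFDerivAt (fun x : E n => A (x - y0)) (A ∘L ContinuousLinearMap.id ℝ (E n)) x :=
    A.hasFDerivAt.comp x h0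
  have h2 : HasFDerivAt (fun x : E n => B (x - y0)) (B ∘L ContinuousLinearMap.id ℝ (E n)) x :=
    B.hasFDerivAt.comp x h0
  have h3 := ((h1.const_add a).add ((h2.clm_apply h0).const_mul (1 / 2)))
  refine h3.congr_fderiv ?_
  ext w
  simp [hB w x, hB w y0]
  ring

lemma taylor_bound {n : ℕ} (f : E n → ℝ) (U : Set (E n)) (hU : IsOpen U) (y0 : E n) (δ K : ℝ)
    (hδ : 0 ≤ δ) (hball : closedBall y0 δ ⊆ U) (hf : ContDiffOn ℝ 2 f U)
    (hK : ∀ x ∈ closedBall y0 δ, ‖fderiv ℝ (fderiv ℝ f) x - fderiv ℝ (fderiv ℝ f) y0‖ ≤ K)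
    (l : List (Fin n)) (hl : l.length ≤ 2) (x : E n) (hx : x ∈ closedBall y0 δ) :
    |δ ^ l.length * (l.foldr pd
        (taylor (f y0) (fderiv ℝ f y0) (fderiv ℝ (fderiv ℝ f) y0) y0) x - l.foldr pd f x)|
      ≤ K * δ ^ 2 := by
  have hy0 : y0 ∈ closedBall y0 δ := mem_closedBall_self hδ
  have hK0 : 0 ≤ K := le_trans (norm_nonneg (fderiv ℝ (fderiv ℝ f) y0 - fderiv ℝ (fderiv ℝ f) y0)) (hK y0 hy0)
  have hca : ∀ x ∈ U, ContDiffAt ℝ 2 f x := fun x hx => hf.contDiffAt (hU.mem_nhds hx)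
  set A := fderiv ℝ f y0 with hA
  set B := fderiv ℝ (fderiv ℝ f) y0 with hBdef
  have hB : ∀ u w, B u w = B w u := fun u w =>
    ((hca y0 (hball hy0)).isSymmSndFDerivAt (by simp)) u w
  have hd1 : ∀ x ∈ U, HasFDerivAt f (fderiv ℝ f x) x := fun x hx =>
    ((hca x hx).differentiableAt (by norm_num)).hasFDerivAt
  have hd2 : ∀ x ∈ U, HasFDerivAt (fderiv ℝ f) (fderiv ℝ (fderiv ℝ f) x) x := fun x hx =>
    (((hca x hx).fderiv_right (m := 1) (by norm_num)).differentiableAt (by norm_num)).hasFDerivAt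
  have hT := taylor_hasFDeriv (f y0) A B y0 hB
  have hTf : fderiv ℝ (taylor (f y0) A B y0) = fun x => A + B (x - y0) :=
    funext fun x => (hT x).fderiv
  have hT2 : ∀ x, HasFDerivAt (fun x : E n => A + B (x - y0)) B x := fun x => by
    have h0 : HasFDerivAt (fun x : E n => x - y0) (ContinuousLinearMap.id ℝ (E n)) x :=
      (hasFDerivAt_id x).sub_const y0
    exact ((B.hasFDerivAt.comp x h0).const_add A)
  have hconv := convex_closedBall y0 δ
  have hb1 : ∀ x ∈ closedBall y0 δ, ‖A + B (x - y0) - fderiv ℝ f x‖ ≤ K * δ := by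
    intro x hx
    have h := hconv.norm_image_sub_le_of_norm_hasFDerivWithin_le (𝕜 := ℝ)
      (f := fun x => (A + B (x - y0)) - fderiv ℝ f x)
      (f' := fun x => B - fderiv ℝ (fderiv ℝ f) x) (C := K)
      (fun z hz => ((hT2 z).sub (hd2 z (hball hz))).hasFDerivWithinAt)
      (fun z hz => by rw [norm_sub_rev]; exact hK z hz) hy0 hx
    simp only [sub_self, map_zero, add_zero, ← hA, sub_zero] at h
    exact h.trans (by gcongr; exact mem_closedBall_iff_norm.1 hx)
  have hb0 : ∀ x ∈ closedBall y0 δ, ‖taylor (f y0) A B y0 x - f x‖ ≤ K * δ * δ := by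
    intro x hx
    have h := hconv.norm_image_sub_le_of_norm_hasFDerivWithin_le (𝕜 := ℝ)
      (f := fun x => taylor (f y0) A B y0 x - f x)
      (f' := fun x => (A + B (x - y0)) - fderiv ℝ f x) (C := K * δ)
      (fun z hz => ((hT z).sub (hd1 z (hball hz))).hasFDerivWithinAt)
      hb1 hy0 hx
    have e : taylor (f y0) A B y0 y0 = f y0 := by simp [taylor]
    simp only [e, sub_self, sub_zero] at h
    exact h.trans (by gcongr; exact mem_closedBall_iff_norm.1 hx)
  have hs : ∀ i : Fin n, ‖(EuclideanSpace.single i (1:ℝ) : E n)‖ = 1 := by intro i; simp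
  match l, hl with
  | [], _ =>
    have := hb0 x hx
    simp only [List.foldr_nil, List.length_nil, pow_zero, one_mul]
    rw [← Real.norm_eq_abs]
    linarith
  | [i], _ =>
    simp only [List.foldr_cons, List.foldr_nil, List.length_cons, List.length_nil, pd, hTf]
    rw [abs_mul, zero_add, pow_one, abs_of_nonneg hδ]
    have h := (A + B (x - y0) - fderiv ℝ f x).le_opNorm (EuclideanSpace.single i 1)
    rw [hs, mul_one, ContinuousLinearMap.sub_apply, Real.norm_eq_abs] at h
    have := mul_le_mul_of_nonneg_left (h.trans (hb1 x hx)) hδ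
    linarith
  | [i, j], _ =>
    simp only [List.foldr_cons, List.foldr_nil, List.length_cons, List.length_nil]
    have e1 : pd i (pd j f) x
        = fderiv ℝ (fderiv ℝ f) x (EuclideanSpace.single i 1) (EuclideanSpace.single j 1) := by
      have := (hd2 x (hball hx)).clm_apply (hasFDerivAt_const (EuclideanSpace.single j 1) x)
      unfold pd
      rw [this.fderiv]
      simp
    have e2 : pd i (pd j (taylor (f y0) A B y0)) x
        = B (EuclideanSpace.single i 1) (EuclideanSpace.single j 1) := by
      have := (hT2 x).clm_apply (hasFDerivAt_const (EuclideanSpace.single j 1) x)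
      unfold pd
      rw [hTf, this.fderiv]
      simp
    rw [e1, e2, abs_mul, abs_of_nonneg (by positivity)]
    have h := (fderiv ℝ (fderiv ℝ f) x - B).le_opNorm₂ (EuclideanSpace.single i 1)
      (EuclideanSpace.single j 1)
    rw [hs, hs, mul_one, mul_one, ContinuousLinearMap.sub_apply, ContinuousLinearMap.sub_apply,
      Real.norm_eq_abs, abs_sub_comm] at h
    have := mul_le_mul_of_nonneg_left (h.trans (hK x hx)) (sq_nonneg δ)
    norm_num
    linarith

lemma taylor_eq_quad {n : ℕ} (f : E n → ℝ) (y0 : E n) :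
    taylor (f y0) (fderiv ℝ f y0) (fderiv ℝ (fderiv ℝ f) y0) y0 =
      quadModel (f y0) (gradVec f y0) (hessMat f y0) y0 := by
  funext x
  simp only [taylor, quadModel, gradVec, hessMat, Matrix.of_apply]
  rw [clm_expand (fderiv ℝ f y0), bilin_expand]
  simp

lemma quadModel_sub {n : ℕ} (c c' : ℝ) (g g' : Fin n → ℝ) (H H' : Matrix (Fin n) (Fin n) ℝ)
    (y0 : E n) :
    quadModel (c - c') (g - g') (H - H') y0 =
      fun x => quadModel c g H y0 x - quadModel c' g' H' y0 x := by
  funext x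
  simp only [quadModel, Pi.sub_apply, Matrix.sub_apply, mul_sub, sub_mul, Finset.sum_sub_distrib]
  ring

/-- fully quadratic models: Hessian error bound. -/
theorem hessian_error_bound {n : ℕ} (hn : 1 ≤ n)
    (y : BIdx n → E n) (α : BIdx n → Fin n → ℕ)
    (hα : ∀ i, mdeg (α i) ≤ 2) (h0 : α (Sum.inl ()) = fun _ => 0)
    (hrad : 0 < rad y) (hpoised : IsUnit (Mhat y α))
    (Δ : ℝ) (hΔ : rad y ≤ Δ)
    (f : E n → ℝ) (U : Set (E n)) (hU : IsOpen U)
    (hUball : closedBall (center y) (2 * Δ) ⊆ U)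
    (hf : ContDiffOn ℝ 2 f U) (L : ℝ)
    (hLip : ∀ w ∈ U, ∀ z ∈ U, specNorm (hessMat f z - hessMat f w) ≤ L * ‖z - w‖)
    (c : ℝ) (g : Fin n → ℝ) (H : Matrix (Fin n) (Fin n) ℝ) (hH : H.IsSymm)
    (hinterp : ∀ i, mpd (α i) (quadModel c g H (center y)) (y i) = mpd (α i) f (y i)) :
    ∀ z ∈ closedBall (center y) Δ,
      specNorm (H - hessMat f z)
        ≤ Real.sqrt 2 * kfac α * L * specNorm (Mhat y α)⁻¹ * Δ := by
  intro z hz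
  have hΔ0 : 0 < Δ := hrad.trans_le hΔ
  set y0 := center y with hy0
  set δ := rad y with hδ
  have hyU : closedBall y0 δ ⊆ U := (closedBall_subset_closedBall (by linarith)).trans hUball
  have hyi : ∀ i, y i ∈ closedBall y0 δ := fun i => by
    rw [mem_closedBall_iff_norm, hδ, hy0]
    exact Finset.le_sup' (fun i => ‖y i - center y‖) (Finset.mem_univ i)
  have hy0U : y0 ∈ U := hUball (mem_closedBall_self (by linarith))
  have hzU : z ∈ U := hUball (closedBall_subset_closedBall (by linarith) hz)
  have hL : 0 ≤ L := by
    have hw : y0 + EuclideanSpace.single (⟨0, hn⟩ : Fin n) Δ ∈ U := by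
      apply hUball
      rw [mem_closedBall_iff_norm]
      simp [abs_of_pos hΔ0]
      linarith
    have h := (specNorm_nonneg _).trans (hLip _ hy0U _ hw)
    simp [abs_of_pos hΔ0] at h
    exact nonneg_of_mul_nonneg_left h hΔ0
  have hsym : (hessMat f y0).IsSymm := by
    ext i j
    exact ((hf.contDiffAt (hU.mem_nhds hy0U)).isSymmSndFDerivAt (by simp)) _ _
  set N := specNorm (Mhat y α)⁻¹ with hN
  have hS := hH.sub hsym
  set v := coef δ (c - f y0) (g - gradVec f y0) (H - hessMat f y0) hS with hv
  have hK : ∀ x ∈ closedBall y0 δ,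
      ‖fderiv ℝ (fderiv ℝ f) x - fderiv ℝ (fderiv ℝ f) y0‖ ≤ L * δ := by
    intro x hx
    refine (bilin_norm_le _ (hessMat f x - hessMat f y0) (fun i j => rfl)).trans ?_
    refine (hLip _ hy0U _ (hyU hx)).trans ?_
    gcongr
    exact mem_closedBall_iff_norm.1 hx
  have hb : ∀ i, |(Mhat y α).mulVec v i| ≤ L * δ ^ 3 := by
    intro i
    obtain ⟨l, hl, hm⟩ := mpd_list (α i)
    have h1 : (Mhat y α).mulVec v i = l.foldr pd (evalP v) (yhat y i) := by
      have := congrFun (foldr_sum l v natBasis natBasis_smooth) (yhat y i)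
      unfold evalP
      rw [this]
      simp only [Matrix.mulVec, dotProduct, Mhat, Matrix.of_apply, hm]
      exact Finset.sum_congr rfl fun j _ => mul_comm _ _
    have hev : ContDiff ℝ (⊤ : ℕ∞) (evalP v) := by
      unfold evalP
      exact ContDiff.sum fun j _ => contDiff_const.mul (natBasis_smooth j)
    have h2 := congrFun (foldr_scale l δ⁻¹ y0 hev) (y i)
    rw [← quadModel_eq δ _ hrad.ne' _ _ hS y0, quadModel_sub,
      foldr_sub l (quadModel_smooth _ _ _ _) (quadModel_smooth _ _ _ _), ← hm, hinterp i, hm,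
      ← taylor_eq_quad] at h2
    have h3 := taylor_bound f U hU y0 δ (L * δ) hrad.le hyU hf hK l (hl.le.trans (hα i)) (y i)
      (hyi i)
    have h4 : (Mhat y α).mulVec v i = - (δ ^ l.length * (l.foldr pd
        (taylor (f y0) (fderiv ℝ f y0) (fderiv ℝ (fderiv ℝ f) y0) y0) (y i)
        - l.foldr pd f (y i))) := by
      rw [h1, ← mul_neg, neg_sub, h2, ← mul_assoc, ← mul_pow, mul_inv_cancel₀ hrad.ne', one_pow,
        one_mul]
      rfl
    rw [h4, abs_neg]
    linarith
  have hdet : IsUnit (Mhat y α).det := (Matrix.isUnit_iff_isUnit_det _).1 hpoised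
  set C : ℝ := (Fintype.card (BIdx n) : ℝ) with hC
  have hvn : ∑ k, v k ^ 2 ≤ N ^ 2 * (C * (L * δ ^ 3) ^ 2) := by
    have h := specNorm_mulVec (Mhat y α)⁻¹ ((Mhat y α).mulVec v)
    rw [Matrix.mulVec_mulVec, Matrix.nonsing_inv_mul _ hdet, Matrix.one_mulVec] at h
    refine h.trans ?_
    gcongr
    calc _ ≤ ∑ _i : BIdx n, (L * δ ^ 3) ^ 2 :=
          Finset.sum_le_sum fun i _ => sq_le_sq' (abs_le.1 (hb i)).1 (abs_le.1 (hb i)).2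
      _ = _ := by simp [hC]
  have hN1 : 1 ≤ N := by
    refine one_le_specNorm_inv _ hpoised (Sum.inl ()) fun j => ?_
    obtain ⟨l, hl, hm⟩ := mpd_list (α (Sum.inl ()))
    have hl0 : l = [] := by
      rw [← List.length_eq_zero_iff, hl, h0]; simp [mdeg]
    subst hl0
    have hz : yhat y (Sum.inl ()) = 0 := by simp [yhat, center]
    simp only [Mhat, Matrix.of_apply, hm, List.foldr_nil, hz]
    rcases j with _ | i | s
    · simp [natBasis]
    · simp [natBasis]
    · induction s using Sym2.ind with
      | _ a b => simp [natBasis]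
  have hC0 : 0 ≤ C := by positivity
  have hC2 : 2 ≤ C := by
    rw [hC]
    simp only [Fintype.card_sum, Fintype.card_unit, Fintype.card_fin]
    have : (1:ℝ) ≤ n := by exact_mod_cast hn
    push_cast
    have h : (0:ℝ) ≤ (Fintype.card (Sym2 (Fin n)) : ℝ) := by positivity
    linarith
  have hmain : specNorm (H - hessMat f y0) ≤ √2 * √C * L * N * δ := by
    refine specNorm_le_frob _ _ (by positivity) ?_
    have h := frob_le δ (c - f y0) (g - gradVec f y0) (H - hessMat f y0) hS
    have h4 : 0 < δ ^ 4 := by positivity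
    refine le_of_mul_le_mul_left ?_ h4
    refine (h.trans (mul_le_mul_of_nonneg_left hvn (by norm_num))).trans (le_of_eq ?_)
    simp only [mul_pow]
    rw [Real.sq_sqrt (by norm_num), Real.sq_sqrt hC0]
    ring
  have hk : 3 / 2 * √C ≤ kfac α := by
    unfold kfac
    apply Real.le_sqrt_of_sq_le
    rw [mul_pow, Real.sq_sqrt hC0]
    have hc : Fintype.card (BIdx n) = ncount α 0 + ncount α 1 + ncount α 2 := by
      have := Finset.card_eq_sum_card_fiberwise (s := (Finset.univ : Finset (BIdx n)))
        (t := Finset.range 3) (f := fun i => mdeg (α i))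
        (fun i _ => by simpa using Nat.lt_succ_of_le (hα i))
      rw [Finset.card_univ] at this
      rw [this]
      simp [Finset.sum_range_succ, ncount]
    rw [hC, hc]
    push_cast
    have h1 : (0:ℝ) ≤ ncount α 1 := by positivity
    have h2 : (0:ℝ) ≤ ncount α 2 := by positivity
    linarith
  have hz2 : specNorm (hessMat f y0 - hessMat f z) ≤ L * Δ := by
    refine (hLip _ hzU _ hy0U).trans ?_
    gcongr
    rw [norm_sub_rev]
    exact mem_closedBall_iff_norm.1 hz
  have hsplit : H - hessMat f z = (H - hessMat f y0) + (hessMat f y0 - hessMat f z) := by abel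
  have hsc : √2 * √2 ≤ √2 * √C := by gcongr
  rw [Real.mul_self_sqrt (by norm_num)] at hsc
  calc _ ≤ √2 * √C * L * N * δ + L * Δ := by
        rw [hsplit]
        exact (specNorm_add_le _ _).trans (add_le_add hmain hz2)
    _ ≤ √2 * √C * L * N * Δ + (1 / 2 * (√2 * √C)) * L * N * Δ := by
        have : 1 * L * 1 * Δ ≤ (1 / 2 * (√2 * √C)) * L * N * Δ := by
          gcongr
          linarith
        have h5 : √2 * √C * L * N * δ ≤ √2 * √C * L * N * Δ := by gcongr
        linarith
    _ = √2 * (3 / 2 * √C) * L * N * Δ := by ring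
    _ ≤ _ := by gcongr
end
end

section
/- Let D be poised Birkhoff interpolation data with (y^0, 0) ∈ D, every |α^i| ≤ 2, and Δ(Y) ≤ Δ. Let f : R^n → R be twice continuously differentiable with ∇²f Lipschitz continuous with constant L on an open set containing B̄(y^0, 2Δ), and let m(y^0 + s) = c + g^T s + (1/2) s^T H s be the quadratic Birkhoff interpolant of f, i.e., (∂^{α^i} m)(y^i) = (∂^{α^i} f)(y^i) for all i = 0, …, q. Let n_ℓ = #{i : |α^i| = ℓ} for ℓ = 0, 1, 2. Then for all y in the closed ball B̄(y^0, Δ), the gradient error satisfies ‖∇m(y) − ∇f(y)‖ ≤ (1 + √2) · ((9/4)n_0 + 4 n_1 + 4 n_2)^{1/2} · L · ‖M̂^{-1}‖₂ · Δ². -/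
noncomputable section

open Metric

lemma foldr_pd {n : ℕ} (α : Fin n → ℕ) (l : List (Fin n)) (f : E n → ℝ) :
    l.foldr (fun i g => (pd i)^[α i] g) f
      = (l.flatMap (fun i => List.replicate (α i) i)).foldr pd f := by
  induction l with
  | nil => rfl
  | cons a l ih =>
    simp only [List.foldr_cons, List.flatMap_cons, List.foldr_append, ih]
    generalize (List.foldr pd f (List.flatMap (fun i => List.replicate (α i) i) l)) = h
    induction α a with
    | zero => rfl
    | succ k ihk => rw [Function.iterate_succ_apply', ihk, List.replicate_succ, List.foldr_cons]

lemma mpd_cases {n : ℕ} (α : Fin n → ℕ) (hα : mdeg α ≤ 2) :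
    (mdeg α = 0 ∧ ∀ f : E n → ℝ, mpd α f = f) ∨
    (mdeg α = 1 ∧ ∃ i, ∀ f : E n → ℝ, mpd α f = pd i f) ∨
    (mdeg α = 2 ∧ ∃ i j, ∀ f : E n → ℝ, mpd α f = pd i (pd j f)) := by
  have hl : ((List.finRange n).flatMap (fun i => List.replicate (α i) i)).length = mdeg α := by
    simp [List.length_flatMap, mdeg, Fin.sum_univ_def]
  have hm : ∀ f : E n → ℝ, mpd α f =
      ((List.finRange n).flatMap (fun i => List.replicate (α i) i)).foldr pd f := fun f =>
    foldr_pd α _ f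
  generalize (List.finRange n).flatMap (fun i => List.replicate (α i) i) = l at hl hm
  match l, hl, hm with
  | [], hl, hm => exact Or.inl ⟨hl.symm, hm⟩
  | [a], hl, hm => exact Or.inr (Or.inl ⟨hl.symm, a, hm⟩)
  | [a, b], hl, hm => exact Or.inr (Or.inr ⟨hl.symm, a, b, hm⟩)
  | a :: b :: c :: t, hl, hm => simp at hl; omega

/-- gradient CLM of the model -/
def qgrad {n : ℕ} (g : Fin n → ℝ) (H : Matrix (Fin n) (Fin n) ℝ) (y0 x : E n) : E n →L[ℝ] ℝ :=
  ∑ i, (g i + ∑ j, H i j * (x j - y0 j)) • (EuclideanSpace.proj i : E n →L[ℝ] ℝ)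

lemma hasFDerivAt_quad {n : ℕ} (c : ℝ) (g : Fin n → ℝ) (H : Matrix (Fin n) (Fin n) ℝ)
    (hH : H.IsSymm) (y0 x : E n) :
    HasFDerivAt (quadModel c g H y0) (qgrad g H y0 x) x := by
  have hp : ∀ i, HasFDerivAt (fun x : E n => x i - y0 i)
      (EuclideanSpace.proj i : E n →L[ℝ] ℝ) x := fun i =>
    ((EuclideanSpace.proj i : E n →L[ℝ] ℝ).hasFDerivAt).sub_const _
  have h1 : HasFDerivAt (fun x : E n => ∑ i, g i * (x i - y0 i))
      (∑ i, g i • (EuclideanSpace.proj i : E n →L[ℝ] ℝ)) x :=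
    HasFDerivAt.fun_sum fun i _ => (hp i).const_mul (g i)
  have h2 := HasFDerivAt.fun_sum (u := Finset.univ) fun i (_ : i ∈ Finset.univ) =>
    HasFDerivAt.fun_sum (u := Finset.univ) fun j (_ : j ∈ Finset.univ) =>
      ((hp i).mul_const (H i j)).mul (hp j)
  have h3 := (h1.const_add c).add (h2.const_mul (1/2))
  refine h3.congr_fderiv ?_
  have hpr : ∀ i (u : E n), (EuclideanSpace.proj i : E n →L[ℝ] ℝ) u = u i := fun _ _ => rfl
  ext u
  simp only [qgrad, add_apply, sum_apply,
    smul_apply, smul_eq_mul, hpr, add_mul,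
    Finset.sum_add_distrib]
  congr 1
  have : ∑ i, ∑ j, (x j - y0 j) * (H i j * u i) = ∑ i, ∑ j, (x i - y0 i) * H i j * u j := by
    rw [Finset.sum_comm]
    refine Finset.sum_congr rfl fun i _ => Finset.sum_congr rfl fun j _ => ?_
    rw [hH.apply]; ring
  rw [this, ← two_mul, ← mul_assoc]
  norm_num
  rw [← this]
  refine Finset.sum_congr rfl fun i _ => ?_
  rw [Finset.sum_mul]
  refine Finset.sum_congr rfl fun j _ => ?_
  ring

lemma pd_quad {n : ℕ} (c : ℝ) (g : Fin n → ℝ) (H : Matrix (Fin n) (Fin n) ℝ)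
    (hH : H.IsSymm) (y0 : E n) (i : Fin n) :
    pd i (quadModel c g H y0) = fun x => g i + ∑ j, H i j * (x j - y0 j) := by
  funext x
  simp [pd, (hasFDerivAt_quad c g H hH y0 x).fderiv, qgrad]

lemma pd_pd_quad {n : ℕ} (c : ℝ) (g : Fin n → ℝ) (H : Matrix (Fin n) (Fin n) ℝ)
    (hH : H.IsSymm) (y0 : E n) (i j : Fin n) :
    pd i (pd j (quadModel c g H y0)) = fun x => H i j := by
  rw [pd_quad c g H hH]
  funext x
  have hp : ∀ i, HasFDerivAt (fun x : E n => x i - y0 i)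
      (EuclideanSpace.proj i : E n →L[ℝ] ℝ) x := fun i =>
    ((EuclideanSpace.proj i : E n →L[ℝ] ℝ).hasFDerivAt).sub_const _
  have h1 : HasFDerivAt (fun x : E n => g j + ∑ k, H j k * (x k - y0 k))
      (∑ k, H j k • (EuclideanSpace.proj k : E n →L[ℝ] ℝ)) x :=
    (HasFDerivAt.fun_sum fun i _ => (hp i).const_mul (H j i)).const_add _
  simp [pd, h1.fderiv, hH.apply]

/-- model from a coefficient vector -/
def qm {n : ℕ} (v : BIdx n → ℝ) : E n → ℝ :=
  quadModel (v (Sum.inl ())) (fun i => v (Sum.inr (Sum.inl i)))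
    (Matrix.of fun i j => v (Sum.inr (Sum.inr s(i, j)))) 0

lemma qm_symm {n : ℕ} (v : BIdx n → ℝ) :
    (Matrix.of fun i j : Fin n => v (Sum.inr (Sum.inr s(i, j)))).IsSymm := by
  ext i j
  simp [Sym2.eq_swap]

lemma natBasis_eq {n : ℕ} (j : BIdx n) :
    natBasis j = qm (fun k => if j = k then 1 else 0) := by
  funext x
  rcases j with u | i | s
  · simp [natBasis, qm, quadModel]
  · simp [natBasis, qm, quadModel]
  · induction s using Sym2.ind with
    | _ a b =>
    simp only [natBasis, Sym2.lift_mk, qm, quadModel]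
    simp only [reduceCtorEq, if_false, zero_mul, Finset.sum_const_zero, zero_add, Matrix.of_apply,
      Sum.inr.injEq, PiLp.zero_apply, sub_zero]
    by_cases h : a = b
    · subst h
      have : ∀ i j, (s(a,a) = s(i,j)) = (a = i ∧ a = j) := by
        intro i j; simp only [Sym2.eq_iff, eq_iff_iff]; tauto
      simp only [this, ite_and, mul_ite, ite_mul, mul_one, mul_zero, zero_mul]
      simp
    · have : ∀ i j, (if s(a,b) = s(i,j) then (1:ℝ) else 0) =
          (if a = i then (if b = j then 1 else 0) else 0)
          + (if b = i then (if a = j then 1 else 0) else 0) := by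
        intro i j
        simp only [Sym2.eq_iff]
        grind
      simp only [this, mul_add, add_mul, mul_ite, ite_mul, mul_one, mul_zero, zero_mul, 
        Finset.sum_add_distrib]
      simp [h]
      ring

lemma mpd_qm_linear {n : ℕ} (α : Fin n → ℕ) (hα : mdeg α ≤ 2) (x : E n) :
    IsLinearMap ℝ (fun v : BIdx n → ℝ => mpd α (qm v) x) := by
  rcases mpd_cases α hα with ⟨_, h⟩ | ⟨_, i, h⟩ | ⟨_, i, j, h⟩
  · simp only [h]
    constructor
    · intro v w
      simp only [qm, quadModel, Pi.add_apply, Matrix.of_apply, mul_add, add_mul,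
        Finset.sum_add_distrib]
      ring
    · intro r v
      simp only [qm, quadModel, Pi.smul_apply, Matrix.of_apply, smul_eq_mul, mul_add,
        Finset.mul_sum]
      congr 1
      · congr 1
        exact Finset.sum_congr rfl fun _ _ => by ring
      · exact Finset.sum_congr rfl fun _ _ => Finset.sum_congr rfl fun _ _ => by ring
  · simp only [h, qm, pd_quad _ _ _ (qm_symm _)]
    constructor
    · intro v w
      simp only [Pi.add_apply, Matrix.of_apply, add_mul,
        Finset.sum_add_distrib]
      ring
    · intro r v
      simp only [Pi.smul_apply, Matrix.of_apply, smul_eq_mul, mul_add,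
        Finset.mul_sum, mul_assoc]
  · simp only [h, qm, pd_pd_quad _ _ _ (qm_symm _)]
    exact ⟨fun v w => rfl, fun r v => rfl⟩

lemma Mhat_mulVec {n : ℕ} (y : BIdx n → E n) (α : BIdx n → Fin n → ℕ)
    (hα : ∀ i, mdeg (α i) ≤ 2) (v : BIdx n → ℝ) (i : BIdx n) :
    (Mhat y α).mulVec v i = mpd (α i) (qm v) (yhat y i) := by
  have := LinearMap.pi_apply_eq_sum_univ (IsLinearMap.mk' _ (mpd_qm_linear (α i) (hα i) (yhat y i))) v
  simp only [IsLinearMap.mk'_apply] at this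
  rw [this]
  simp only [Matrix.mulVec, dotProduct, Mhat, Matrix.of_apply, natBasis_eq, smul_eq_mul]
  exact Finset.sum_congr rfl fun j _ => mul_comm _ _

lemma sum_sym2_le {n : ℕ} (h : Sym2 (Fin n) → ℝ) (hh : ∀ s, 0 ≤ h s) :
    ∑ i, ∑ j, h s(i, j) ≤ 2 * ∑ s, h s := by
  rw [← Fintype.sum_prod_type' (f := fun i j => h s(i,j)),
    ← Finset.sum_fiberwise (s := Finset.univ) (g := fun p : Fin n × Fin n => s(p.1, p.2)),
    Finset.mul_sum]
  refine Finset.sum_le_sum fun s _ => ?_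
  have : ∀ p ∈ Finset.univ.filter (fun p : Fin n × Fin n => s(p.1, p.2) = s),
      h s(p.1, p.2) = h s := by
    intro p hp; rw [(Finset.mem_filter.1 hp).2]
  rw [Finset.sum_congr rfl this, Finset.sum_const, nsmul_eq_mul]
  refine mul_le_mul_of_nonneg_right ?_ (hh s)
  induction s using Sym2.ind with
  | _ a b =>
  have hsub : Finset.univ.filter (fun p : Fin n × Fin n => s(p.1, p.2) = s(a,b))
      ⊆ {(a,b),(b,a)} := by
    intro p hp
    have := (Finset.mem_filter.1 hp).2
    rw [Sym2.eq_iff] at this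
    rcases p with ⟨p, q⟩
    simpa using this
  exact_mod_cast (Finset.card_le_card hsub).trans Finset.card_le_two

lemma specNorm_bilin {n : ℕ} (M : Matrix (Fin n) (Fin n) ℝ) (u w : E n) :
    |∑ i, ∑ j, u i * M i j * w j| ≤ specNorm M * ‖u‖ * ‖w‖ := by
  have h1 := abs_real_inner_le_norm u (Matrix.toEuclideanCLM (𝕜 := ℝ) M w)
  have h2 := (Matrix.toEuclideanCLM (𝕜 := ℝ) M).le_opNorm w
  have h3 : inner ℝ u (Matrix.toEuclideanCLM (𝕜 := ℝ) M w) = ∑ i, ∑ j, u i * M i j * w j := by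
    simp only [PiLp.inner_apply, Matrix.ofLp_toEuclideanCLM, Matrix.mulVec, dotProduct,
      Real.inner_apply, Finset.mul_sum, mul_assoc]
  rw [← h3]
  refine h1.trans ?_
  calc _ ≤ ‖u‖ * (specNorm M * ‖w‖) := by gcongr; exact h2
    _ = _ := by ring


/-- second derivative of the model -/
def qhess {n : ℕ} (H : Matrix (Fin n) (Fin n) ℝ) : E n →L[ℝ] E n →L[ℝ] ℝ :=
  ∑ i, (∑ j, H i j • (EuclideanSpace.proj j : E n →L[ℝ] ℝ)).smulRight
    (EuclideanSpace.proj i : E n →L[ℝ] ℝ)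

lemma hasFDerivAt_qgrad {n : ℕ} (g : Fin n → ℝ) (H : Matrix (Fin n) (Fin n) ℝ) (y0 x : E n) :
    HasFDerivAt (qgrad g H y0) (qhess H) x := by
  have hp : ∀ i, HasFDerivAt (fun x : E n => x i - y0 i)
      (EuclideanSpace.proj i : E n →L[ℝ] ℝ) x := fun i =>
    ((EuclideanSpace.proj i : E n →L[ℝ] ℝ).hasFDerivAt).sub_const _
  have h1 : ∀ j, HasFDerivAt (fun x : E n => g j + ∑ k, H j k * (x k - y0 k))
      (∑ k, H j k • (EuclideanSpace.proj k : E n →L[ℝ] ℝ)) x := fun j =>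
    (HasFDerivAt.fun_sum fun i _ => (hp i).const_mul (H j i)).const_add _
  exact HasFDerivAt.fun_sum (u := Finset.univ) fun i _ => (h1 i).smul_const (EuclideanSpace.proj i : E n →L[ℝ] ℝ)

lemma qhess_apply {n : ℕ} (H : Matrix (Fin n) (Fin n) ℝ) (hH : H.IsSymm) (u w : E n) :
    qhess H u w = ∑ i, ∑ j, u i * H i j * w j := by
  have hpr : ∀ i (u : E n), (EuclideanSpace.proj i : E n →L[ℝ] ℝ) u = u i := fun _ _ => rfl
  simp only [qhess, sum_apply, ContinuousLinearMap.smulRight_apply, smul_apply, smul_eq_mul, hpr,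
    Finset.sum_mul]
  rw [Finset.sum_comm]
  refine Finset.sum_congr rfl fun i _ => Finset.sum_congr rfl fun j _ => ?_
  rw [hH.apply]; ring

lemma euclid_sum {n : ℕ} (u : E n) : u = ∑ i, u i • EuclideanSpace.single i (1:ℝ) := by
  ext j
  simp [Pi.single_apply]

lemma bil_apply {n : ℕ} (f : E n → ℝ) (x u w : E n) :
    fderiv ℝ (fderiv ℝ f) x u w = ∑ i, ∑ j, u i * hessMat f x i j * w j := by
  conv_lhs => rw [euclid_sum u, euclid_sum w]
  simp only [map_sum, map_smul, sum_apply, smul_apply, smul_eq_mul, hessMat, Matrix.of_apply,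
    Finset.mul_sum]
  rw [Finset.sum_comm]
  refine Finset.sum_congr rfl fun i _ => Finset.sum_congr rfl fun j _ => ?_
  ring

lemma hess_bound {n : ℕ} (f : E n → ℝ) (x y0 : E n) (hs : (hessMat f y0).IsSymm) :
    ‖qhess (hessMat f y0) - fderiv ℝ (fderiv ℝ f) x‖
      ≤ specNorm (hessMat f y0 - hessMat f x) := by
  refine ContinuousLinearMap.opNorm_le_bound₂ _ (norm_nonneg _) fun u w => ?_
  have := specNorm_bilin (hessMat f y0 - hessMat f x) u w
  rw [sub_apply, sub_apply, qhess_apply _ hs, bil_apply, Real.norm_eq_abs,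
    ← Finset.sum_sub_distrib]
  simp only [← Finset.sum_sub_distrib, ← sub_mul, ← mul_sub]
  exact this

section taylor
variable {n : ℕ} {f : E n → ℝ} {U : Set (E n)} {y0 : E n} {L R : ℝ}

lemma diff2 (hU : IsOpen U) (hf : ContDiffOn ℝ 2 f U) {x : E n} (hx : x ∈ U) :
    HasFDerivAt f (fderiv ℝ f x) x ∧
    HasFDerivAt (fderiv ℝ f) (fderiv ℝ (fderiv ℝ f) x) x := by
  have h := hf.contDiffAt (hU.mem_nhds hx)
  refine ⟨(h.differentiableAt (by norm_num)).hasFDerivAt, ?_⟩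
  exact ((h.fderiv_right (m := 1) (by norm_num)).differentiableAt (by norm_num)).hasFDerivAt

lemma hess_symm (hU : IsOpen U) (hf : ContDiffOn ℝ 2 f U) {x : E n} (hx : x ∈ U) :
    (hessMat f x).IsSymm := by
  have h := (hf.contDiffAt (hU.mem_nhds hx)).isSymmSndFDerivAt (by simp)
  ext i j
  exact h _ _

lemma pd_pd_eq (hU : IsOpen U) (hf : ContDiffOn ℝ 2 f U) {x : E n} (hx : x ∈ U) (i j : Fin n) :
    pd i (pd j f) x = hessMat f x i j := by
  have h := (diff2 hU hf hx).2
  have h2 : HasFDerivAt (pd j f) _ x := h.clm_apply (hasFDerivAt_const (EuclideanSpace.single j (1:ℝ)) x)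
  rw [pd, h2.fderiv]
  simp [hessMat]

/-- Taylor polynomial -/
def tay (f : E n → ℝ) (y0 : E n) : E n → ℝ := quadModel (f y0) (gradVec f y0) (hessMat f y0) y0

lemma tay_grad (hU : IsOpen U) (hball : closedBall y0 R ⊆ U) (hf : ContDiffOn ℝ 2 f U)
    (hL : 0 ≤ L)
    (hLip : ∀ w ∈ U, ∀ z ∈ U, specNorm (hessMat f z - hessMat f w) ≤ L * ‖z - w‖)
    {x : E n} (hx : x ∈ closedBall y0 R) :
    ‖qgrad (gradVec f y0) (hessMat f y0) y0 x - fderiv ℝ f x‖ ≤ L * R ^ 2 := by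
  have hR : 0 ≤ R := dist_nonneg.trans (mem_closedBall.1 hx)
  have hy0 : y0 ∈ closedBall y0 R := mem_closedBall_self hR
  have hs := hess_symm hU hf (hball hy0)
  have key := (convex_closedBall y0 R).norm_image_sub_le_of_norm_hasFDerivWithin_le
    (f := fun x => qgrad (gradVec f y0) (hessMat f y0) y0 x - fderiv ℝ f x)
    (f' := fun x => qhess (hessMat f y0) - fderiv ℝ (fderiv ℝ f) x) (C := L * R)
    (fun z hz => ((hasFDerivAt_qgrad _ _ _ z).sub (diff2 hU hf (hball hz)).2).hasFDerivWithinAt)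
    (fun z hz => (hess_bound f z y0 hs).trans ((hLip z (hball hz) y0 (hball hy0)).trans
      (by rw [norm_sub_rev, ← dist_eq_norm]; exact mul_le_mul_of_nonneg_left hz hL)))
    hy0 hx
  have h0 : qgrad (gradVec f y0) (hessMat f y0) y0 y0 - fderiv ℝ f y0 = 0 := by
    ext u
    conv_lhs => rw [euclid_sum u]
    simp [qgrad, gradVec, sum_apply, mul_comm]
  rw [h0, sub_zero] at key
  refine key.trans ?_
  rw [← dist_eq_norm]
  calc _ ≤ L * R * R := by gcongr; exact hx
    _ = _ := by ring

lemma tay_val (hU : IsOpen U) (hball : closedBall y0 R ⊆ U) (hf : ContDiffOn ℝ 2 f U)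
    (hL : 0 ≤ L)
    (hLip : ∀ w ∈ U, ∀ z ∈ U, specNorm (hessMat f z - hessMat f w) ≤ L * ‖z - w‖)
    {x : E n} (hx : x ∈ closedBall y0 R) :
    |tay f y0 x - f x| ≤ L * R ^ 3 := by
  have hR : 0 ≤ R := dist_nonneg.trans (mem_closedBall.1 hx)
  have hy0 : y0 ∈ closedBall y0 R := mem_closedBall_self hR
  have hs := hess_symm hU hf (hball hy0)
  have key := (convex_closedBall y0 R).norm_image_sub_le_of_norm_hasFDerivWithin_le
    (f := fun x => tay f y0 x - f x)
    (f' := fun x => qgrad (gradVec f y0) (hessMat f y0) y0 x - fderiv ℝ f x) (C := L * R ^ 2)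
    (fun z hz => ((hasFDerivAt_quad _ _ _ hs y0 z).sub
      (diff2 hU hf (hball hz)).1).hasFDerivWithinAt)
    (fun z hz => tay_grad hU hball hf hL hLip hz)
    hy0 hx
  have h0 : tay f y0 y0 - f y0 = 0 := by simp [tay, quadModel]
  rw [h0, sub_zero] at key
  refine key.trans ?_
  rw [← dist_eq_norm]
  calc _ ≤ L * R ^ 2 * R := by gcongr; exact hx
    _ = _ := by ring

lemma tay_mpd (hU : IsOpen U) (hball : closedBall y0 R ⊆ U) (hf : ContDiffOn ℝ 2 f U)
    (hL : 0 ≤ L)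
    (hLip : ∀ w ∈ U, ∀ z ∈ U, specNorm (hessMat f z - hessMat f w) ≤ L * ‖z - w‖)
    {x : E n} (hx : x ∈ closedBall y0 R) (α : Fin n → ℕ) (hα : mdeg α ≤ 2) :
    |R ^ (mdeg α) * (mpd α (tay f y0) x - mpd α f x)| ≤ L * R ^ 3 := by
  have hR : 0 ≤ R := dist_nonneg.trans (mem_closedBall.1 hx)
  have hy0 : y0 ∈ closedBall y0 R := mem_closedBall_self hR
  have hs := hess_symm hU hf (hball hy0)
  rw [abs_mul, abs_of_nonneg (pow_nonneg hR _)]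
  rcases mpd_cases α hα with ⟨h, e⟩ | ⟨h, i, e⟩ | ⟨h, i, j, e⟩
  · rw [h, e, e]
    simpa using tay_val hU hball hf hL hLip hx
  · rw [h, e, e]
    have h1 := ContinuousLinearMap.le_opNorm
      (qgrad (gradVec f y0) (hessMat f y0) y0 x - fderiv ℝ f x) (EuclideanSpace.single i (1:ℝ))
    have h2 := tay_grad hU hball hf hL hLip hx
    rw [sub_apply, ← (hasFDerivAt_quad (f y0) _ _ hs y0 x).fderiv] at h1
    rw [← (hasFDerivAt_quad (f y0) _ _ hs y0 x).fderiv] at h2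
    have h3 : |pd i (tay f y0) x - pd i f x| ≤ L * R ^ 2 := by
      refine (le_trans h1 ?_)
      simpa using h2
    calc _ ≤ R ^ 1 * (L * R ^ 2) := by gcongr
      _ = _ := by ring
  · rw [h, e, e, pd_pd_eq hU hf (hball hx), tay, pd_pd_quad _ _ _ hs]
    have h1 := hLip x (hball hx) y0 (hball hy0)
    have h2 := specNorm_bilin (hessMat f y0 - hessMat f x) (EuclideanSpace.single i (1:ℝ))
      (EuclideanSpace.single j (1:ℝ))
    simp at h2
    have h3 : ‖y0 - x‖ ≤ R := by rw [norm_sub_rev, ← dist_eq_norm]; exact hx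
    calc _ ≤ R ^ 2 * (L * R) := by
          gcongr
          exact h2.trans (h1.trans (by gcongr))
      _ = _ := by ring

end taylor

/-- scaled coefficient vector -/
def coefV {n : ℕ} (ρ c : ℝ) (g : Fin n → ℝ) (H : Matrix (Fin n) (Fin n) ℝ) (hH : H.IsSymm) :
    BIdx n → ℝ
  | Sum.inl _ => c
  | Sum.inr (Sum.inl i) => ρ * g i
  | Sum.inr (Sum.inr s) => Sym2.lift ⟨fun i j => ρ ^ 2 * H i j, fun i j => congrArg (ρ ^ 2 * ·) (hH.apply j i)⟩ s

lemma quad_sub {n : ℕ} (c c' : ℝ) (g g' : Fin n → ℝ) (H H' : Matrix (Fin n) (Fin n) ℝ)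
    (hH : H.IsSymm) (hH' : H'.IsSymm) (y0 x : E n) (α : Fin n → ℕ) (hα : mdeg α ≤ 2) :
    mpd α (quadModel (c - c') (g - g') (H - H') y0) x
      = mpd α (quadModel c g H y0) x - mpd α (quadModel c' g' H' y0) x := by
  have hs := hH.sub hH'
  rcases mpd_cases α hα with ⟨h, e⟩ | ⟨h, i, e⟩ | ⟨h, i, j, e⟩
  · simp only [e, quadModel, Pi.sub_apply, Matrix.sub_apply, sub_mul, mul_sub,
      Finset.sum_sub_distrib]
    ring
  · simp only [e, pd_quad _ _ _ hs, pd_quad _ _ _ hH, pd_quad _ _ _ hH', Pi.sub_apply,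
      Matrix.sub_apply, sub_mul, Finset.sum_sub_distrib]
    ring
  · simp only [e, pd_pd_quad _ _ _ hs, pd_pd_quad _ _ _ hH, pd_pd_quad _ _ _ hH',
      Matrix.sub_apply]

lemma mpd_coefV {n : ℕ} (ρ c : ℝ) (hρ : 0 < ρ) (g : Fin n → ℝ) (H : Matrix (Fin n) (Fin n) ℝ)
    (hH : H.IsSymm) (y0 x : E n) (α : Fin n → ℕ) (hα : mdeg α ≤ 2) :
    mpd α (qm (coefV ρ c g H hH)) (ρ⁻¹ • (x - y0))
      = ρ ^ mdeg α * mpd α (quadModel c g H y0) x := by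
  have hρ' := hρ.ne'
  rcases mpd_cases α hα with ⟨h, e⟩ | ⟨h, i, e⟩ | ⟨h, i, j, e⟩
  · simp only [e, h, qm, quadModel, coefV, Matrix.of_apply, Sym2.lift_mk, pow_zero, one_mul,
      PiLp.smul_apply, PiLp.sub_apply, PiLp.zero_apply, sub_zero, smul_eq_mul]
    congr 1
    · congr 1
      exact Finset.sum_congr rfl fun _ _ => by field_simp
    · congr 1
      exact Finset.sum_congr rfl fun _ _ => Finset.sum_congr rfl fun _ _ => by field_simp
  · simp only [e, h, qm, pd_quad _ _ _ (qm_symm _), pd_quad _ _ _ hH]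
    simp only [coefV, Matrix.of_apply,
      Sym2.lift_mk, PiLp.smul_apply, PiLp.sub_apply, PiLp.zero_apply, sub_zero, smul_eq_mul,
      pow_one, mul_add, Finset.mul_sum]
    congr 1
    exact Finset.sum_congr rfl fun _ _ => by field_simp
  · simp only [e, h, qm, pd_pd_quad _ _ _ (qm_symm _), pd_pd_quad _ _ _ hH]
    simp only [coefV,
      Matrix.of_apply, Sym2.lift_mk]

lemma coefV_norms {n : ℕ} (ρ c : ℝ) (hρ : 0 < ρ) (g : Fin n → ℝ) (H : Matrix (Fin n) (Fin n) ℝ)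
    (hH : H.IsSymm) :
    ρ ^ 2 * ∑ i, g i ^ 2 ≤ ‖WithLp.toLp 2 (coefV ρ c g H hH)‖ ^ 2 ∧
    ρ ^ 4 * ∑ i, ∑ j, H i j ^ 2 ≤ 2 * ‖WithLp.toLp 2 (coefV ρ c g H hH)‖ ^ 2 := by
  have hsum : ‖WithLp.toLp 2 (coefV ρ c g H hH)‖ ^ 2 = c ^ 2 + (∑ i, (ρ * g i) ^ 2
      + ∑ s : Sym2 (Fin n), coefV ρ c g H hH (Sum.inr (Sum.inr s)) ^ 2) := by
    rw [EuclideanSpace.real_norm_sq_eq]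
    simp [Fintype.sum_sum_type, coefV]
  have h1 : ∑ i, (ρ * g i) ^ 2 = ρ ^ 2 * ∑ i, g i ^ 2 := by
    rw [Finset.mul_sum]; exact Finset.sum_congr rfl fun _ _ => by ring
  have h2 := sum_sym2_le (fun s : Sym2 (Fin n) => coefV ρ c g H hH (Sum.inr (Sum.inr s)) ^ 2)
    (fun s => sq_nonneg _)
  have h3 : ∑ i, ∑ j, coefV ρ c g H hH (Sum.inr (Sum.inr s(i, j))) ^ 2
      = ρ ^ 4 * ∑ i, ∑ j, H i j ^ 2 := by
    simp only [Finset.mul_sum]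
    refine Finset.sum_congr rfl fun _ _ => Finset.sum_congr rfl fun _ _ => ?_
    simp only [coefV, Sym2.lift_mk]; ring
  rw [h3] at h2
  have p1 : 0 ≤ ∑ i, g i ^ 2 := Finset.sum_nonneg fun _ _ => sq_nonneg _
  have p2 : 0 ≤ ∑ s : Sym2 (Fin n), coefV ρ c g H hH (Sum.inr (Sum.inr s)) ^ 2 :=
    Finset.sum_nonneg fun _ _ => sq_nonneg _
  have p3 := mul_nonneg (sq_nonneg ρ) p1
  rw [hsum, h1]
  constructor <;> nlinarith [sq_nonneg c]

lemma inv_bound {ι : Type*} [Fintype ι] [DecidableEq ι] (M : Matrix ι ι ℝ) (hM : IsUnit M)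
    (v : ι → ℝ) : ‖WithLp.toLp 2 v‖ ≤ specNorm M⁻¹ * ‖WithLp.toLp 2 (M.mulVec v)‖ := by
  have h := (Matrix.toEuclideanCLM (𝕜 := ℝ) M⁻¹).le_opNorm (WithLp.toLp 2 (M.mulVec v))
  rwa [Matrix.toEuclideanCLM_toLp, Matrix.mulVec_mulVec,
    Matrix.nonsing_inv_mul _ ((Matrix.isUnit_iff_isUnit_det _).1 hM), Matrix.one_mulVec] at h

lemma one_le_specNorm {n : ℕ} (y : BIdx n → E n) (α : BIdx n → Fin n → ℕ)
    (hα : ∀ i, mdeg (α i) ≤ 2) (h0 : α (Sum.inl ()) = fun _ => 0)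
    (hp : IsUnit (Mhat y α)) : 1 ≤ specNorm (Mhat y α)⁻¹ := by
  set w := (Mhat y α)⁻¹.mulVec (Pi.single (Sum.inl ()) 1) with hw
  have hMw : (Mhat y α).mulVec w = Pi.single (Sum.inl ()) 1 := by
    rw [hw, Matrix.mulVec_mulVec,
      Matrix.mul_nonsing_inv _ ((Matrix.isUnit_iff_isUnit_det _).1 hp), Matrix.one_mulVec]
  have hd : mdeg (α (Sum.inl ())) = 0 := by simp [h0, mdeg]
  have hw0 : w (Sum.inl ()) = 1 := by
    have h1 := Mhat_mulVec y α hα w (Sum.inl ())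
    rw [hMw, Pi.single_eq_same] at h1
    rcases mpd_cases _ (hα (Sum.inl ())) with ⟨h, e⟩ | ⟨h, -⟩ | ⟨h, -⟩
    · rw [e] at h1
      simpa [qm, quadModel, yhat, center] using h1.symm
    · omega
    · omega
  have h2 := inv_bound _ hp w
  rw [hMw] at h2
  have h3 : ‖WithLp.toLp 2 (Pi.single (Sum.inl ()) (1:ℝ) : BIdx n → ℝ)‖ = 1 := by
    rw [PiLp.norm_toLp_single]; simp
  have h4 := PiLp.norm_apply_le (WithLp.toLp 2 w) (Sum.inl ())
  rw [h3] at h2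
  simp only [hw0, norm_one] at h4
  linarith

lemma kfac_bound {n : ℕ} (α : BIdx n → Fin n → ℕ) (hα : ∀ i, mdeg (α i) ≤ 2) :
    1 ≤ Real.sqrt (Fintype.card (BIdx n)) ∧
    3 / 2 * Real.sqrt (Fintype.card (BIdx n)) ≤ kfac α := by
  have hc : Fintype.card (BIdx n) = ncount α 0 + ncount α 1 + ncount α 2 := by
    simp only [ncount, Finset.card_filter, ← Finset.sum_add_distrib]
    rw [Fintype.card_eq_sum_ones]
    refine Finset.sum_congr rfl fun i _ => ?_
    have := hα i
    interval_cases mdeg (α i) <;> simp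
  have h1 : 1 ≤ Fintype.card (BIdx n) := Fintype.card_pos
  constructor
  · rw [Real.one_le_sqrt]; exact_mod_cast h1
  · rw [kfac]
    apply Real.le_sqrt_of_sq_le
    rw [mul_pow, Real.sq_sqrt (by positivity), hc]
    push_cast
    have a := Nat.cast_nonneg (α := ℝ) (ncount α 1)
    have b := Nat.cast_nonneg (α := ℝ) (ncount α 2)
    linarith

lemma dual_norm {n : ℕ} (l : E n →L[ℝ] ℝ) :
    ‖(WithLp.toLp 2 (fun i => l (EuclideanSpace.single i 1)) : E n)‖ ≤ ‖l‖ := by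
  set u : E n := WithLp.toLp 2 (fun i => l (EuclideanSpace.single i 1)) with hu
  have h1 : l u = ‖u‖ ^ 2 := by
    rw [EuclideanSpace.real_norm_sq_eq]
    conv_lhs => rw [euclid_sum u]
    simp only [map_sum, map_smul, smul_eq_mul]
    exact Finset.sum_congr rfl fun i _ => by rw [sq, hu]
  have h2 := (le_abs_self _).trans (l.le_opNorm u)
  rw [h1] at h2
  by_contra! h
  have : 0 < ‖u‖ := (norm_nonneg l).trans_lt h
  nlinarith

lemma le_of_sq_le_sq' {a b : ℝ} (h : a ^ 2 ≤ b ^ 2) (hb : 0 ≤ b) : a ≤ b :=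
  (le_abs_self a).trans (abs_le_of_sq_le_sq h hb)

lemma mulVec_norm {n : ℕ} (B : Matrix (Fin n) (Fin n) ℝ) (d : E n) :
    ‖(WithLp.toLp 2 (fun i => ∑ j, B i j * d j) : E n)‖ ^ 2
      ≤ (∑ i, ∑ j, B i j ^ 2) * ‖d‖ ^ 2 := by
  rw [EuclideanSpace.real_norm_sq_eq, EuclideanSpace.real_norm_sq_eq, Finset.sum_mul]
  exact Finset.sum_le_sum fun i _ =>
    Finset.sum_mul_sq_le_sq_mul_sq Finset.univ (fun j => B i j) (fun j => d j)

/-- fully quadratic models: gradient error bound. -/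
theorem gradient_error_bound {n : ℕ} (hn : 1 ≤ n)
    (y : BIdx n → E n) (α : BIdx n → Fin n → ℕ)
    (hα : ∀ i, mdeg (α i) ≤ 2) (h0 : α (Sum.inl ()) = fun _ => 0)
    (hrad : 0 < rad y) (hpoised : IsUnit (Mhat y α))
    (Δ : ℝ) (hΔ : rad y ≤ Δ)
    (f : E n → ℝ) (U : Set (E n)) (hU : IsOpen U)
    (hUball : closedBall (center y) (2 * Δ) ⊆ U)
    (hf : ContDiffOn ℝ 2 f U) (L : ℝ)
    (hLip : ∀ w ∈ U, ∀ z ∈ U, specNorm (hessMat f z - hessMat f w) ≤ L * ‖z - w‖)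
    (c : ℝ) (g : Fin n → ℝ) (H : Matrix (Fin n) (Fin n) ℝ) (hH : H.IsSymm)
    (hinterp : ∀ i, mpd (α i) (quadModel c g H (center y)) (y i) = mpd (α i) f (y i)) :
    ∀ z ∈ closedBall (center y) Δ,
      Real.sqrt (∑ i, (g i + (∑ j, H i j * (z j - center y j)) - gradVec f z i) ^ 2)
        ≤ (1 + Real.sqrt 2) * kfac α * L * specNorm (Mhat y α)⁻¹ * Δ ^ 2 := by
  intro z hz
  have hΔ0 : 0 < Δ := hrad.trans_le hΔ
  obtain ⟨y0, hy0⟩ : ∃ y0, y0 = center y := ⟨_, rfl⟩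
  obtain ⟨ρ, hρd⟩ : ∃ ρ, ρ = rad y := ⟨_, rfl⟩
  have hyi : ∀ i, y i ∈ closedBall y0 ρ := by
    intro i
    rw [mem_closedBall, dist_eq_norm, hρd, hy0]
    exact Finset.le_sup' (fun i => ‖y i - center y‖) (Finset.mem_univ i)
  have hyh : ∀ i, yhat y i = ρ⁻¹ • (y i - y0) := fun i => by rw [hρd, hy0, yhat]
  rw [← hy0] at hUball hinterp hz ⊢
  rw [← hρd] at hrad hΔ
  have hbΔ : closedBall y0 Δ ⊆ U := (closedBall_subset_closedBall (by linarith)).trans hUball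
  have hbρ : closedBall y0 ρ ⊆ U := (closedBall_subset_closedBall hΔ).trans hbΔ
  have hyU : y0 ∈ U := hbΔ (mem_closedBall_self hΔ0.le)
  have hL : 0 ≤ L := by
    have hx : y0 + EuclideanSpace.single (⟨0, hn⟩ : Fin n) Δ ∈ U := by
      apply hbΔ
      simp [abs_of_pos hΔ0]
    have h1 := hLip y0 hyU _ hx
    have h2 : (0:ℝ) ≤ L * Δ := by
      refine (norm_nonneg _).trans (h1.trans_eq ?_)
      simp [abs_of_pos hΔ0]
    exact nonneg_of_mul_nonneg_left h2 hΔ0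
  have hs := hess_symm hU hf hyU
  obtain ⟨hK1, hK2⟩ := kfac_bound α hα
  have hS := one_le_specNorm y α hα h0 hpoised
  generalize hSd : specNorm (Mhat y α)⁻¹ = S at hS ⊢
  generalize hκd : kfac α = κ at hK2 ⊢
  -- coefficient vector
  set B := H - hessMat f y0 with hB
  have hBs : B.IsSymm := hH.sub hs
  set gd := g - gradVec f y0 with hgd
  set v := coefV ρ (c - f y0) gd B hBs with hv
  have hb : ∀ i, |(Mhat y α).mulVec v i| ≤ L * ρ ^ 3 := by
    intro i
    rw [Mhat_mulVec y α hα, hyh, hv, mpd_coefV ρ _ hrad _ _ _ y0 _ _ (hα i), hB, hgd,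
      quad_sub _ _ _ _ _ _ hH hs _ _ _ (hα i), hinterp i, abs_mul, abs_sub_comm, ← abs_mul]
    exact tay_mpd hU hbρ hf hL hLip (hyi i) (α i) (hα i)
  obtain ⟨hn1, hn2⟩ := coefV_norms ρ (c - f y0) hrad gd B hBs
  rw [← hv] at hn1 hn2
  have hvb := inv_bound _ hpoised v
  rw [hSd] at hvb
  have hbn : ‖WithLp.toLp 2 ((Mhat y α).mulVec v)‖
      ≤ L * ρ ^ 3 * Real.sqrt (Fintype.card (BIdx n)) := by
    have hnn : 0 ≤ L * ρ ^ 3 := by positivity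
    refine le_of_sq_le_sq' ?_ (by positivity)
    rw [EuclideanSpace.real_norm_sq_eq, mul_pow, Real.sq_sqrt (by positivity)]
    calc _ ≤ ∑ i : BIdx n, (L * ρ ^ 3) ^ 2 :=
          Finset.sum_le_sum fun i _ => sq_le_sq' (abs_le.1 (hb i)).1 (abs_le.1 (hb i)).2
      _ = _ := by simp [mul_comm]
  generalize Real.sqrt (Fintype.card (BIdx n)) = K at hK1 hK2 hbn
  have hV : ‖WithLp.toLp 2 v‖ ≤ S * (L * ρ ^ 3 * K) := by
    refine hvb.trans ?_
    gcongr
  have hV0 : 0 ≤ ‖WithLp.toLp 2 v‖ := norm_nonneg _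
  generalize ‖WithLp.toLp 2 v‖ = V at hV hV0 hn1 hn2
  have hzd : ‖z - y0‖ ≤ Δ := by rw [← dist_eq_norm]; exact hz
  -- pieces
  set eg : E n := WithLp.toLp 2 gd with heg
  set eH : E n := WithLp.toLp 2 (fun i => ∑ j, B i j * (z - y0) j) with heH
  set l := qgrad (gradVec f y0) (hessMat f y0) y0 z - fderiv ℝ f z with hl
  set eT : E n := WithLp.toLp 2 (fun i => l (EuclideanSpace.single i 1)) with heT
  have hV2 : V ^ 2 ≤ (S * (L * ρ ^ 3 * K)) ^ 2 := by gcongr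
  have hM0 : 0 ≤ S * (L * ρ ^ 3 * K) := by positivity
  have b1 : ‖eg‖ ≤ S * L * K * Δ ^ 2 := by
    have h1 : (ρ * ‖eg‖) ^ 2 ≤ (S * (L * ρ ^ 3 * K)) ^ 2 := by
      rw [mul_pow, EuclideanSpace.real_norm_sq_eq]
      exact hn1.trans hV2
    have h2 := le_of_sq_le_sq' h1 hM0
    have h3 : ‖eg‖ ≤ S * L * K * ρ ^ 2 := by
      refine le_of_mul_le_mul_left ?_ hrad
      linarith
    refine h3.trans ?_
    gcongr
  have b2 : ‖eH‖ ≤ Real.sqrt 2 * (S * L * K * Δ ^ 2) := by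
    have h1 : (ρ ^ 2 * ‖eH‖) ^ 2 ≤ (Real.sqrt 2 * (S * (L * ρ ^ 3 * K)) * Δ) ^ 2 := by
      have h3 := mulVec_norm B (z - y0)
      rw [← heH] at h3
      have h4 : ‖z - y0‖ ^ 2 ≤ Δ ^ 2 := by gcongr
      have h5 : Real.sqrt 2 ^ 2 = 2 := Real.sq_sqrt (by norm_num)
      calc (ρ ^ 2 * ‖eH‖) ^ 2 = ρ ^ 4 * ‖eH‖ ^ 2 := by ring
        _ ≤ ρ ^ 4 * ((∑ i, ∑ j, B i j ^ 2) * ‖z - y0‖ ^ 2) := by gcongr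
        _ = (ρ ^ 4 * (∑ i, ∑ j, B i j ^ 2)) * ‖z - y0‖ ^ 2 := by ring
        _ ≤ (2 * (S * (L * ρ ^ 3 * K)) ^ 2) * Δ ^ 2 := by
            refine mul_le_mul (hn2.trans ?_) h4 (by positivity) (by positivity)
            gcongr
        _ = _ := by rw [mul_pow _ Δ, mul_pow (Real.sqrt 2), h5]
    have h2 := le_of_sq_le_sq' h1 (by positivity)
    have h3 : ‖eH‖ ≤ Real.sqrt 2 * (S * L * K * (ρ * Δ)) := by
      refine le_of_mul_le_mul_left ?_ (pow_pos hrad 2)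
      linarith
    refine h3.trans ?_
    have : ρ * Δ ≤ Δ ^ 2 := by rw [sq]; gcongr
    gcongr
  have b3 : ‖eT‖ ≤ L * Δ ^ 2 :=
    (dual_norm l).trans (tay_grad hU hbΔ hf hL hLip hz)
  have hsum : Real.sqrt (∑ i, (g i + (∑ j, H i j * (z j - y0 j)) - gradVec f z i) ^ 2)
      = ‖eg + eH + eT‖ := by
    rw [EuclideanSpace.norm_eq]
    congr 1
    refine Finset.sum_congr rfl fun i _ => ?_
    rw [Real.norm_eq_abs, sq_abs]
    congr 1
    simp [heg, heH, heT, hl, hgd, hB, qgrad, sub_mul, Finset.sum_sub_distrib, gradVec]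
    ring
  rw [hsum]
  refine (norm_add_le _ _).trans ((add_le_add_left (norm_add_le _ _) _).trans ?_)
  have h2 : (1:ℝ) ≤ Real.sqrt 2 := by rw [Real.one_le_sqrt]; norm_num
  have hP : 0 ≤ L * Δ ^ 2 := by positivity
  have h3 : (1:ℝ) ≤ S * (κ - K) * (1 + Real.sqrt 2) := by
    have h4 : 1 / 2 ≤ κ - K := by linarith
    calc (1:ℝ) = 1 * (1 / 2) * (1 + 1) := by norm_num
      _ ≤ _ := by gcongr
  have h5 := mul_le_mul_of_nonneg_left h3 hP
  linarith
end
end
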